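/- arXiv:1109.4200 — 2 statements merged into one kernel-verified Lean document; each statement's English description precedes it below -/
import Mathlib

section
/- Let n ≥ 2 and let u : ℝⁿ → ℝ (Euclidean space) be a C² function with u(0) = 0 and Du(0) = 0, and suppose the second derivative of u at 0 is positive definite, i.e., there is m > 0 with D²u(0)(v,v) ≥ m‖v‖² for all v ∈ ℝⁿ. Then there exist r > 0 and ε > 0 such that: (i) for every c with 0 < c < ε, the level set S_c = {x : ‖x‖ ≤ r and u(x) = c} is nonempty, every point x ∈ S_c satisfies Du(x) ≠ 0 (S_c is a regular level set), and S_c is homeomorphic to the unit sphere of ℝⁿ; and (ii) for every c with −ε < c < 0, the set {x : ‖x‖ ≤ r and u(x) = c} is empty. -/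
open Set

section RadialLevelSets

variable {E : Type*} [NormedAddCommGroup E] [NormedSpace ℝ E]

/-- Near a critical point with positive definite second derivative, the radial derivative is
positive away from the critical point. -/
lemma exists_radial_fderiv_pos {u : E → ℝ} (hu : ContDiff ℝ 2 u) (hDu0 : fderiv ℝ u 0 = 0)
    {m : ℝ} (hm : 0 < m) (hpos : ∀ v : E, m * ‖v‖ ^ 2 ≤ iteratedFDeriv ℝ 2 u 0 ![v, v]) :
    ∃ r > (0 : ℝ), ∀ x : E, ‖x‖ ≤ r → x ≠ 0 → 0 < fderiv ℝ u x x := by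
  have hD : HasFDerivAt (fderiv ℝ u) (fderiv ℝ (fderiv ℝ u) 0) 0 :=
    ((hu.fderiv_right (m := 1) (by norm_num)).differentiable (by norm_num) 0).hasFDerivAt
  obtain ⟨r, hr, hball⟩ := Metric.nhds_basis_closedBall.eventually_iff.mp
    (hD.isLittleO.def (half_pos hm))
  refine ⟨r, hr, fun x hx hx0 => ?_⟩
  have hnorm : 0 < ‖x‖ := norm_pos_iff.mpr hx0
  have hbound := hball (mem_closedBall_zero_iff.mpr hx)
  simp only [hDu0, sub_zero] at hbound
  have happly := (fderiv ℝ u x - fderiv ℝ (fderiv ℝ u) 0 x).le_opNorm x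
  have hA := hpos x
  rw [iteratedFDeriv_two_apply] at hA
  simp only [Matrix.cons_val_zero, Matrix.cons_val_one] at hA
  rw [sub_apply, Real.norm_eq_abs] at happly
  have hlow := (abs_le.mp happly).1
  nlinarith [mul_le_mul_of_nonneg_right hbound hnorm.le, mul_pos hm (pow_pos hnorm 2)]

/-- A function with positive radial derivative is strictly increasing along rays. -/
lemma strictMonoOn_ray_of_radial_fderiv_pos {u : E → ℝ} (hu : Differentiable ℝ u) {r : ℝ}
    (hrad : ∀ x : E, ‖x‖ ≤ r → x ≠ 0 → 0 < fderiv ℝ u x x) {e : E} (he : ‖e‖ = 1) :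
    StrictMonoOn (fun t : ℝ => u (t • e)) (Icc 0 r) := by
  have hderiv (t : ℝ) : HasDerivAt (fun t : ℝ => u (t • e)) (fderiv ℝ u (t • e) e) t := by
    have hray : HasDerivAt (fun t : ℝ => t • e) e t := by
      simpa using (hasDerivAt_id t).smul_const e
    exact (hu (t • e)).hasFDerivAt.comp_hasDerivAt t hray
  refine strictMonoOn_of_deriv_pos (convex_Icc 0 r)
    (fun t _ => (hderiv t).continuousAt.continuousWithinAt) fun t ht => ?_
  rw [interior_Icc] at ht
  rw [(hderiv t).deriv]
  have he0 : e ≠ 0 := norm_pos_iff.mp (he ▸ one_pos)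
  have hpos := hrad (t • e) (by rw [norm_smul, he, mul_one, Real.norm_of_nonneg ht.1.le]
                                exact ht.2.le) (smul_ne_zero ht.1.ne' he0)
  rw [map_smul, smul_eq_mul] at hpos
  exact pos_of_mul_pos_right hpos ht.1.le

/-- A function vanishing at the origin with positive radial derivative is positive off the
origin. -/
lemma pos_of_radial_fderiv_pos {u : E → ℝ} (hu : Differentiable ℝ u) (hu0 : u 0 = 0) {r : ℝ}
    (hrad : ∀ x : E, ‖x‖ ≤ r → x ≠ 0 → 0 < fderiv ℝ u x x) {x : E} (hx : ‖x‖ ≤ r)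
    (hx0 : x ≠ 0) : 0 < u x := by
  have hnorm : 0 < ‖x‖ := norm_pos_iff.mpr hx0
  have hmono := strictMonoOn_ray_of_radial_fderiv_pos hu hrad (norm_smul_inv_norm (𝕜 := ℝ) hx0)
    ⟨le_rfl, hnorm.le.trans hx⟩ ⟨hnorm.le, hx⟩ hnorm
  simpa [hu0, smul_smul, hnorm.ne'] using hmono

/-- Radial projection is a homeomorphism from a low positive level set onto the unit sphere. -/
lemma nonempty_homeomorph_levelSet_sphere [ProperSpace E] {u : E → ℝ} (hu : Differentiable ℝ u)
    (hu0 : u 0 = 0) {r : ℝ} (hr : 0 < r)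
    (hrad : ∀ x : E, ‖x‖ ≤ r → x ≠ 0 → 0 < fderiv ℝ u x x) {c : ℝ} (hc : 0 < c)
    (hcr : ∀ x : E, ‖x‖ = r → c < u x) :
    Nonempty ({x : E | ‖x‖ ≤ r ∧ u x = c} ≃ₜ Metric.sphere (0 : E) 1) := by
  have hne (x : {x : E | ‖x‖ ≤ r ∧ u x = c}) : (x : E) ≠ 0 := by
    intro h
    have := x.2.2
    rw [h, hu0] at this
    exact hc.ne this
  have hcompact : IsCompact {x : E | ‖x‖ ≤ r ∧ u x = c} := by
    have := (isCompact_closedBall (0 : E) r).inter_right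
      (isClosed_eq hu.continuous (continuous_const (y := c)))
    convert this using 1
    ext x
    simp
  let f : {x : E | ‖x‖ ≤ r ∧ u x = c} → Metric.sphere (0 : E) 1 := fun x =>
    ⟨‖(x : E)‖⁻¹ • (x : E), mem_sphere_zero_iff_norm.mpr (norm_smul_inv_norm (𝕜 := ℝ) (hne x))⟩
  have hf : Continuous f :=
    ((continuous_subtype_val.norm.inv₀ fun x => norm_ne_zero_iff.mpr (hne x)).smul
      continuous_subtype_val).subtype_mk _
  have hback (x : {x : E | ‖x‖ ≤ r ∧ u x = c}) : ‖(x : E)‖ • (f x : E) = x :=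
    smul_inv_smul₀ (norm_ne_zero_iff.mpr (hne x)) _
  have hinj : Function.Injective f := by
    intro x y hxy
    have hmono := strictMonoOn_ray_of_radial_fderiv_pos hu hrad
      (mem_sphere_zero_iff_norm.mp (f x).2)
    have hnorm : ‖(x : E)‖ = ‖(y : E)‖ := by
      refine hmono.injOn ⟨norm_nonneg _, x.2.1⟩ ⟨norm_nonneg _, y.2.1⟩ ?_
      change u (‖(x : E)‖ • (f x : E)) = u (‖(y : E)‖ • (f x : E))
      rw [hback, hxy, hback, x.2.2, y.2.2]
    ext
    rw [← hback x, ← hback y, hnorm, hxy]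
  have hsurj : Function.Surjective f := by
    intro e
    have he : ‖(e : E)‖ = 1 := mem_sphere_zero_iff_norm.mp e.2
    have hnorm {t : ℝ} (ht : 0 ≤ t) : ‖t • (e : E)‖ = t := by
      rw [norm_smul, he, mul_one, Real.norm_of_nonneg ht]
    have hcont : Continuous fun t : ℝ => u (t • (e : E)) :=
      hu.continuous.comp (continuous_id.smul continuous_const)
    obtain ⟨t, ht, htc⟩ := intermediate_value_Icc hr.le hcont.continuousOn
      (show c ∈ Icc (u ((0 : ℝ) • (e : E))) (u (r • (e : E))) from
        ⟨by rw [zero_smul, hu0]; exact hc.le, (hcr _ (hnorm hr.le)).le⟩)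
    have ht0 : t ≠ 0 := by
      rintro rfl
      simp only [zero_smul, hu0] at htc
      exact hc.ne htc
    refine ⟨⟨t • (e : E), (hnorm ht.1).trans_le ht.2, htc⟩, ?_⟩
    ext
    change ‖t • (e : E)‖⁻¹ • (t • (e : E)) = e
    rw [hnorm ht.1, inv_smul_smul₀ ht0]
  have : CompactSpace {x : E | ‖x‖ ≤ r ∧ u x = c} := isCompact_iff_compactSpace.mp hcompact
  exact ⟨Continuous.homeoOfEquivCompactToT2 (f := Equiv.ofBijective f ⟨hinj, hsurj⟩) hf⟩

end RadialLevelSets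

/-- A C² function `u` on ℝⁿ (n ≥ 2) with `u 0 = 0`, `Du(0) = 0` and
positive-definite second derivative at `0` has, for some `r > 0` and `ε > 0`:
regular nonempty level sets `{‖x‖ ≤ r, u x = c}` homeomorphic to the unit sphere
for `0 < c < ε`, and empty level sets for `-ε < c < 0`. -/
theorem stmt0 (n : ℕ) (hn : 2 ≤ n)
    (u : EuclideanSpace ℝ (Fin n) → ℝ)
    (hu : ContDiff ℝ 2 u) (hu0 : u 0 = 0) (hDu0 : fderiv ℝ u 0 = 0)
    (m : ℝ) (hm : 0 < m)
    (hpos : ∀ v : EuclideanSpace ℝ (Fin n),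
      m * ‖v‖ ^ 2 ≤ iteratedFDeriv ℝ 2 u 0 ![v, v]) :
    ∃ r > (0 : ℝ), ∃ ε > (0 : ℝ),
      (∀ c : ℝ, 0 < c → c < ε →
        ({x : EuclideanSpace ℝ (Fin n) | ‖x‖ ≤ r ∧ u x = c}.Nonempty ∧
         (∀ x : EuclideanSpace ℝ (Fin n), ‖x‖ ≤ r → u x = c → fderiv ℝ u x ≠ 0) ∧
         Nonempty (({x : EuclideanSpace ℝ (Fin n) | ‖x‖ ≤ r ∧ u x = c}) ≃ₜ
           (Metric.sphere (0 : EuclideanSpace ℝ (Fin n)) 1)))) ∧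
      (∀ c : ℝ, -ε < c → c < 0 →
        {x : EuclideanSpace ℝ (Fin n) | ‖x‖ ≤ r ∧ u x = c} = ∅) := by
  have : NeZero n := ⟨by omega⟩
  have hd : Differentiable ℝ u := hu.differentiable (by norm_num)
  obtain ⟨r, hr, hrad⟩ := exists_radial_fderiv_pos hu hDu0 hm hpos
  obtain ⟨p, hp, hmin⟩ := (isCompact_sphere (0 : EuclideanSpace ℝ (Fin n)) r).exists_isMinOn
    (NormedSpace.sphere_nonempty.mpr hr.le) hd.continuous.continuousOn
  rw [mem_sphere_zero_iff_norm] at hp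
  have hp0 : p ≠ 0 := norm_pos_iff.mp (hp ▸ hr)
  refine ⟨r, hr, u p, pos_of_radial_fderiv_pos hd hu0 hrad hp.le hp0, fun c hc hcp => ?_,
    fun c _ hc => ?_⟩
  · obtain ⟨φ⟩ := nonempty_homeomorph_levelSet_sphere hd hu0 hr hrad hc fun x hx =>
      hcp.trans_le (hmin (mem_sphere_zero_iff_norm.mpr hx))
    obtain ⟨e, he⟩ := NormedSpace.sphere_nonempty (x := (0 : EuclideanSpace ℝ (Fin n))).mpr
      zero_le_one
    refine ⟨⟨_, (φ.symm ⟨e, he⟩).2⟩, fun x hx hxc hDx => ?_, ⟨φ⟩⟩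
    have hx0 : x ≠ 0 := by
      rintro rfl
      exact hc.ne (hu0.symm.trans hxc)
    simpa [hDx] using hrad x hx hx0
  · refine eq_empty_of_forall_notMem fun x ⟨hx, hxc⟩ => ?_
    rcases eq_or_ne x 0 with rfl | hx0
    · exact hc.ne (hxc.symm.trans hu0)
    · exact (hxc ▸ hc).not_gt (pos_of_radial_fderiv_pos hd hu0 hrad hx hx0)
end

section
/- Let n ≥ 1 and let E = ℝⁿ (Euclidean space). Let β : E × ℝ → ℝ and H : E × ℝ → ℝ be C¹ functions such that the x-gradient maps (x, z) ↦ ∇_x β(x, z) and (x, s) ↦ ∇_x H(x, s) are also C¹, and suppose: β(x, 0) = 0 for all x; ∂β/∂z(0,0) ≠ 0; H(0,0) = 0; ∇_x H(0,0) = 0; ∂H/∂s(0,0) ≠ 0; and the Hessian map v ↦ D(∇_x H(·, 0))(0)(v) from E to E is invertible. Then there exist ε > 0 and C¹ maps ξ : (−ε, ε) → E and ζ : (−ε, ε) → ℝ with ξ(0) = 0, ζ(0) = 0 and ζ′(0) ≠ 0, such that for every s ∈ (−ε, ε): H(ξ(s), s) = β(ξ(s), ζ(s)); ∇_x H(ξ(s),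 s) = ∇_x β(ξ(s), ζ(s)); and the linear map v ↦ D(∇_x H(·, s))(ξ(s))(v) − D(∇_x β(·, ζ(s)))(ξ(s))(v) is invertible. That is, for each s the graph surface {z = H(x, s)} is tangent to the graph surface {z = β(x, ζ(s))} at the point (ξ(s), H(ξ(s), s)), the tangency is non-degenerate, and the C¹ curve of tangency points crosses the family of surfaces {z = β(·, z₀)} transversely (since ζ′(0) ≠ 0). -/
open scoped Topology ContDiff

section

variable {E F G : Type*} [NormedAddCommGroup E] [NormedSpace ℝ E]
  [NormedAddCommGroup F] [NormedSpace ℝ F] [NormedAddCommGroup G] [NormedSpace ℝ G]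

/-- A map that is `C^n` at a point agrees near that point with a globally `C^n` map. -/
theorem ContDiffAt.exists_contDiff_eventuallyEq [FiniteDimensional ℝ E] {n : ℕ} {f : E → F}
    {a : E} (hf : ContDiffAt ℝ n f a) : ∃ g : E → F, ContDiff ℝ n g ∧ g =ᶠ[𝓝 a] f := by
  obtain ⟨r, hr, hball⟩ := Metric.eventually_nhds_iff_ball.1 (hf.eventually (by simp))
  let b : ContDiffBump a := ⟨r / 4, r / 2, by positivity, by linarith⟩
  refine ⟨fun x => b x • f x, ?_, ?_⟩
  · refine contDiff_iff_contDiffAt.2 fun x => ?_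
    by_cases hx : x ∈ Metric.ball a r
    · exact b.contDiff.contDiffAt.smul (hball x hx)
    · have hx' : x ∉ tsupport b := by
        rw [b.tsupport_eq]
        simp only [Metric.mem_ball, Metric.mem_closedBall, b] at hx ⊢
        linarith
      refine contDiffAt_const (c := (0 : F)) |>.congr_of_eventuallyEq ?_
      filter_upwards [notMem_tsupport_iff_eventuallyEq.1 hx'] with y hy
      simp [hy]
  · filter_upwards [b.eventuallyEq_one] with x hx
    simp [hx]

theorem fderiv_comp_prodMk_left {f : E × F → G} {x : E} {y : F}
    (hf : DifferentiableAt ℝ f (x, y)) :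
    fderiv ℝ (fun x' => f (x', y)) x = fderiv ℝ f (x, y) ∘L .inl ℝ E F :=
  (hf.hasFDerivAt.comp x (hasFDerivAt_prodMk_left x y)).fderiv

theorem deriv_comp_prodMk_right {f : E × ℝ → G} {x : E} {t : ℝ}
    (hf : DifferentiableAt ℝ f (x, t)) :
    deriv (fun t' => f (x, t')) t = fderiv ℝ f (x, t) (0, 1) :=
  (hf.hasFDerivAt.comp_hasDerivAt t
    ((hasDerivAt_const t x).prodMk (hasDerivAt_id t))).deriv

theorem ContinuousLinearMap.eventually_bijective [CompleteSpace E] {X : Type*}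
    [TopologicalSpace X] {A : X → E →L[ℝ] E} {a : X} (hA : ContinuousAt A a)
    (ha : Function.Bijective (A a)) : ∀ᶠ x in 𝓝 a, Function.Bijective (A x) := by
  simp only [← ContinuousLinearMap.isUnit_iff_bijective] at ha ⊢
  exact hA.eventually (Units.isOpen.mem_nhds ha)

/-- An endomorphism of `E × ℝ` whose matrix is block upper triangular, with invertible diagonal
blocks, is invertible. -/
theorem ContinuousLinearMap.isInvertible_of_blockTriangular [FiniteDimensional ℝ E]
    {A : E × ℝ →L[ℝ] E × ℝ} (hfst : Function.Injective fun v => (A (v, 0)).1)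
    {c : ℝ} (hc : c ≠ 0) (hsnd : ∀ p, (A p).2 = c * p.2) : A.IsInvertible := by
  have hinj : Function.Injective A := by
    refine (injective_iff_map_eq_zero A).2 fun ⟨v, w⟩ hvw => ?_
    have hw : w = 0 := by simpa [hvw, hc] using hsnd (v, w)
    subst hw
    have hv : v = 0 := hfst (by simp [hvw, Prod.mk_zero_zero])
    simp [hv]
  exact ⟨(LinearEquiv.ofInjectiveEndo A.toLinearMap hinj).toContinuousLinearEquiv, by ext <;> rfl⟩

end

/-- Proposition 5.1 in graph coordinates: given two families of graphs
`z = β(x, z₀)` and `z = H(x, s)` of codimension-one leaves with a non-degenerate strict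
tangency at the origin, there is a C¹ curve `s ↦ (ξ s, ζ s)` of non-degenerate strict
tangencies between the leaves `{z = H(·, s)}` and `{z = β(·, ζ s)}`, crossing the
family of leaves transversely (`ζ′(0) ≠ 0`). -/
theorem stmt6 (n : ℕ) (hn : 1 ≤ n)
    (β H : EuclideanSpace ℝ (Fin n) × ℝ → ℝ)
    (hβ : ContDiff ℝ 1 β) (hH : ContDiff ℝ 1 H)
    (hβgrad : ContDiff ℝ 1 (fun p : EuclideanSpace ℝ (Fin n) × ℝ =>
      gradient (fun x => β (x, p.2)) p.1))
    (hHgrad : ContDiff ℝ 1 (fun p : EuclideanSpace ℝ (Fin n) × ℝ =>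
      gradient (fun x => H (x, p.2)) p.1))
    (hβ0 : ∀ x : EuclideanSpace ℝ (Fin n), β (x, 0) = 0)
    (hβz : deriv (fun z : ℝ => β (0, z)) 0 ≠ 0)
    (hH0 : H (0, 0) = 0)
    (hHgrad0 : gradient (fun x => H (x, 0)) 0 = 0)
    (hHs : deriv (fun s : ℝ => H (0, s)) 0 ≠ 0)
    (hHess : Function.Bijective
      ⇑(fderiv ℝ (fun x : EuclideanSpace ℝ (Fin n) =>
          gradient (fun y => H (y, 0)) x) 0)) :
    ∃ ε > (0 : ℝ), ∃ ξ : ℝ → EuclideanSpace ℝ (Fin n), ∃ ζ : ℝ → ℝ,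
      ContDiff ℝ 1 ξ ∧ ContDiff ℝ 1 ζ ∧
      ξ 0 = 0 ∧ ζ 0 = 0 ∧ deriv ζ 0 ≠ 0 ∧
      ∀ s ∈ Set.Ioo (-ε) ε,
        H (ξ s, s) = β (ξ s, ζ s) ∧
        gradient (fun x => H (x, s)) (ξ s) = gradient (fun x => β (x, ζ s)) (ξ s) ∧
        Function.Bijective
          ⇑(fderiv ℝ (fun x : EuclideanSpace ℝ (Fin n) =>
              gradient (fun y => H (y, s)) x) (ξ s) -
            fderiv ℝ (fun x : EuclideanSpace ℝ (Fin n) =>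
              gradient (fun y => β (y, ζ s)) x) (ξ s)) := by
  set GH : EuclideanSpace ℝ (Fin n) × ℝ → EuclideanSpace ℝ (Fin n) :=
    fun p => gradient (fun x => H (x, p.2)) p.1 with hGH
  set Gβ : EuclideanSpace ℝ (Fin n) × ℝ → EuclideanSpace ℝ (Fin n) :=
    fun p => gradient (fun x => β (x, p.2)) p.1 with hGβ
  have dH := hH.differentiable one_ne_zero
  have dβ := hβ.differentiable one_ne_zero
  have dGH := hHgrad.differentiable one_ne_zero
  have dGβ := hβgrad.differentiable one_ne_zero
  have hGβ0 : ∀ x, Gβ (x, 0) = 0 := fun x => by simp [hGβ, hβ0, gradient]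
  have hDH : fderiv ℝ H (0, 0) ∘L .inl ℝ _ ℝ = 0 := by
    rw [← fderiv_comp_prodMk_left (dH _), ← toDual_gradient, hHgrad0, map_zero]
  have hDβ : fderiv ℝ β (0, 0) ∘L .inl ℝ _ ℝ = 0 := by
    rw [← fderiv_comp_prodMk_left (dβ _)]
    simp [hβ0]
  have hDGβ : fderiv ℝ Gβ (0, 0) ∘L .inl ℝ _ ℝ = 0 := by
    rw [← fderiv_comp_prodMk_left (dGβ _)]
    simp [hGβ0]
  have hHess' : Function.Bijective (fderiv ℝ GH (0, 0) ∘L .inl ℝ _ ℝ) := by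
    rw [← fderiv_comp_prodMk_left (dGH _)]
    exact hHess
  rw [deriv_comp_prodMk_right (dβ _)] at hβz
  rw [deriv_comp_prodMk_right (dH _)] at hHs
  have hDH_apply : ∀ v t, fderiv ℝ H (0, 0) (v, t) = fderiv ℝ H (0, 0) (0, 1) * t := by
    intro v t
    have h := DFunLike.congr_fun hDH v
    rw [show (v, t) = (v, 0) + t • ((0 : EuclideanSpace ℝ (Fin n)), (1 : ℝ)) by simp, map_add,
      map_smul, smul_eq_mul, mul_comm]
    simpa using h
  have hDβ_apply : ∀ v t, fderiv ℝ β (0, 0) (v, t) = fderiv ℝ β (0, 0) (0, 1) * t := by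
    intro v t
    have h := DFunLike.congr_fun hDβ v
    rw [show (v, t) = (v, 0) + t • ((0 : EuclideanSpace ℝ (Fin n)), (1 : ℝ)) by simp, map_add,
      map_smul, smul_eq_mul, mul_comm]
    simpa using h
  -- The tangency equations, to be solved for `(x, z)` in terms of `s`.
  let f : ℝ × (EuclideanSpace ℝ (Fin n) × ℝ) → EuclideanSpace ℝ (Fin n) × ℝ :=
    fun q => (GH (q.2.1, q.1) - Gβ q.2, H (q.2.1, q.1) - β q.2)
  have hf : ContDiffAt ℝ 1 f (0, (0, 0)) := by
    refine ContDiff.contDiffAt ?_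
    have : ContDiff ℝ 1
        (fun q : ℝ × (EuclideanSpace ℝ (Fin n) × ℝ) => (q.2.1, q.1)) := by fun_prop
    exact ((hHgrad.comp this).sub (hβgrad.comp contDiff_snd)).prodMk
      ((hH.comp this).sub (hβ.comp contDiff_snd))
  have hf0 : f (0, (0, 0)) = 0 := by
    have : GH (0, 0) = 0 := hHgrad0
    simp [f, this, hGβ0, hH0, hβ0]
  have hf' : fderiv ℝ f (0, (0, 0)) ∘L .inr ℝ _ _ =
      (fderiv ℝ GH (0, 0) ∘L .inl ℝ _ ℝ ∘L .fst ℝ _ _ - fderiv ℝ Gβ (0, 0)).prod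
        (fderiv ℝ H (0, 0) ∘L .inl ℝ _ ℝ ∘L .fst ℝ _ _ - fderiv ℝ β (0, 0)) := by
    have hslice : HasFDerivAt (fun p : EuclideanSpace ℝ (Fin n) × ℝ => (p.1, (0 : ℝ)))
        (.inl ℝ _ ℝ ∘L .fst ℝ _ _) (0, 0) :=
      HasFDerivAt.comp (g := fun x : EuclideanSpace ℝ (Fin n) => (x, (0 : ℝ))) (0, 0)
        (hasFDerivAt_prodMk_left 0 0) hasFDerivAt_fst
    have h₁ := (hf.differentiableAt one_ne_zero).hasFDerivAt.comp
      ((0 : EuclideanSpace ℝ (Fin n)), (0 : ℝ)) (hasFDerivAt_prodMk_right (0 : ℝ) (0, 0))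
    have h₂ := (((dGH (0, 0)).hasFDerivAt.comp
        ((0 : EuclideanSpace ℝ (Fin n)), (0 : ℝ)) hslice).sub
        (dGβ (0, 0)).hasFDerivAt).prodMk
      (((dH (0, 0)).hasFDerivAt.comp
        ((0 : EuclideanSpace ℝ (Fin n)), (0 : ℝ)) hslice).sub (dβ (0, 0)).hasFDerivAt)
    exact h₁.unique h₂
  have hinv : (fderiv ℝ f (0, (0, 0)) ∘L .inr ℝ _ _).IsInvertible := by
    rw [hf']
    refine ContinuousLinearMap.isInvertible_of_blockTriangular ?_ (neg_ne_zero.2 hβz) ?_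
    · have hzero : ∀ v, fderiv ℝ Gβ (0, 0) (v, 0) = 0 := fun v => by
        simpa using DFunLike.congr_fun hDGβ v
      have h := hHess'.injective
      simpa [hzero, Function.Injective] using h
    · rintro ⟨v, w⟩
      simp [hDH_apply v 0, hDβ_apply v w]
  obtain ⟨ψ, hψ, hψeq⟩ :=
    ContDiffAt.exists_contDiff_eventuallyEq (n := 1)
      (hf.contDiffAt_implicitFunction one_ne_zero hinv)
  have hψ0 : ψ 0 = (0, 0) :=
    hψeq.self_of_nhds.trans (hf.implicitFunction_apply_self one_ne_zero hinv)
  have hψ1 : ContDiff ℝ 1 ψ := by exact_mod_cast hψ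
  have hsol : ∀ᶠ s in 𝓝 (0 : ℝ), GH ((ψ s).1, s) = Gβ (ψ s) ∧ H ((ψ s).1, s) = β (ψ s) := by
    filter_upwards [hψeq, hf.eventually_apply_implicitFunction one_ne_zero hinv] with s hs hs'
    rw [← hs, hf0, Prod.ext_iff] at hs'
    exact ⟨sub_eq_zero.1 hs'.1, sub_eq_zero.1 hs'.2⟩
  have hcurve : ContDiff ℝ 1 (fun s => ((ψ s).1, s)) := hψ1.fst.prodMk contDiff_id
  have hnondeg : ∀ᶠ s in 𝓝 (0 : ℝ), Function.Bijective
      (fderiv ℝ GH ((ψ s).1, s) ∘L .inl ℝ _ ℝ - fderiv ℝ Gβ (ψ s) ∘L .inl ℝ _ ℝ) := by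
    refine ContinuousLinearMap.eventually_bijective (Continuous.continuousAt ?_) ?_
    · exact (((hHgrad.continuous_fderiv one_ne_zero).comp hcurve.continuous).clm_comp
        continuous_const).sub
        (((hβgrad.continuous_fderiv one_ne_zero).comp hψ1.continuous).clm_comp continuous_const)
    · rw [hψ0, hDGβ, sub_zero]
      exact hHess'
  obtain ⟨ε, hε, hball⟩ := Metric.eventually_nhds_iff_ball.1 (hsol.and hnondeg)
  refine ⟨ε, hε, fun s => (ψ s).1, fun s => (ψ s).2, hψ1.fst, hψ1.snd, by simp [hψ0],
    by simp [hψ0], ?_, fun s hs => ?_⟩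
  · intro hζ
    have hd := (hψ1.differentiable one_ne_zero 0).hasDerivAt
    have hd₂ : (deriv ψ 0).2 = 0 :=
      (hasFDerivAt_snd.comp_hasDerivAt (0 : ℝ) hd).deriv.symm.trans hζ
    have hd₁ := hasFDerivAt_fst.comp_hasDerivAt (0 : ℝ) hd
    have hβ' := (dβ (ψ 0)).hasFDerivAt.comp_hasDerivAt (0 : ℝ) hd
    have hH' := HasFDerivAt.comp_hasDerivAt (f := fun s => ((ψ s).1, s)) (0 : ℝ)
      (dH ((ψ 0).1, 0)).hasFDerivAt (hd₁.prodMk (hasDerivAt_id (0 : ℝ)))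
    have heq := hH'.unique (hβ'.congr_of_eventuallyEq (hsol.mono fun s hs => hs.2))
    rw [hψ0, hDH_apply, ← Prod.mk.eta (p := deriv ψ 0), hDβ_apply, hd₂, mul_zero, mul_one] at heq
    exact hHs heq
  · rw [← Real.ball_zero_eq_Ioo] at hs
    obtain ⟨⟨hgrad, hval⟩, hbij⟩ := hball s hs
    refine ⟨hval, hgrad, ?_⟩
    rw [← Prod.mk.eta (p := ψ s), ← fderiv_comp_prodMk_left (dGH _),
      ← fderiv_comp_prodMk_left (dGβ _)] at hbij
    exact hbij
end
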